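/- arXiv:2302.06164 — 2 statements merged into one kernel-verified Lean document; each statement's English description precedes it below -/
import Mathlib

section
/- Let T be a trust relation and let S ⊆ W × Act × ℝ be closed under the family {T}. Let n ∈ ℕ, let α : Fin (n+1) → Act be a chain of actors and x : Fin n → ℝ a family of weights such that (α i, α (i+1), x i) ∈ T for every i < n (each actor trusts the next with the given weight). If (a, α n, y) ∈ S, then (a, α 0, (∏_{i<n} x i) · y) ∈ S: the weight with which the first actor in the chain accepts the witness is the product of all the link weights times the original weight. -/
/-- A set `S` of weighted judgements is closed under the (singleton family of
the) trust relation `T` iff whenever `(a, β, y) ∈ S` and `(α, β, x) ∈ T`,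
also `(a, α, x * y) ∈ S`. -/
def ClosedUnder {W Act : Type*} (T : Set (Act × Act × ℝ))
    (S : Set (W × Act × ℝ)) : Prop :=
  ∀ a α β x y, (α, β, x) ∈ T → (a, β, y) ∈ S → (a, α, x * y) ∈ S

/-- Along a chain of actors in which each trusts the next, the weight with
which the first actor accepts a witness is the product of all the link
weights times the original weight. -/
theorem trust_chain {W Act : Type*} (T : Set (Act × Act × ℝ))
    (S : Set (W × Act × ℝ)) (hclosed : ClosedUnder T S)
    (n : ℕ) (α : Fin (n + 1) → Act) (x : Fin n → ℝ)
    (hT : ∀ i : Fin n, (α i.castSucc, α i.succ, x i) ∈ T)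
    (a : W) (y : ℝ) (hJ : (a, α (Fin.last n), y) ∈ S) :
    (a, α 0, (∏ i : Fin n, x i) * y) ∈ S := by
  induction n with
  | zero => simpa using hJ
  | succ n ih =>
    rw [Fin.prod_univ_succ, mul_assoc]
    exact hclosed a _ _ _ _ (hT 0)
      (ih (fun i => α i.succ) (fun i => x i.succ) (fun i => hT i.succ) hJ)
end

section
/- Let T ⊆ Act × Act × ℝ be a trust relation all of whose weights are nonnegative (i.e. (α, β, z) ∈ T implies 0 ≤ z). Let S_A ⊆ W × Act × ℝ and S_B ⊆ W × Act × ℝ each be closed under the family {T}. Then the conjunction semantics S_{A∧B} := { ((a,b), α, min x y) | (a, α, x) ∈ S_A and (b, α, y) ∈ S_B } ⊆ (W × W) × Act × ℝ is also closed under {T}. -/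
/-- The conjunction semantics (pairs of witnesses, accepted with the minimum
of the component weights) is closed under `{T}` provided all the trust
weights of `T` are nonnegative. -/
theorem conj_semantics_closed {W Act : Type*} (T : Set (Act × Act × ℝ))
    (hT : ∀ α β z, (α, β, z) ∈ T → 0 ≤ z)
    (SA SB : Set (W × Act × ℝ))
    (hA : ClosedUnder T SA) (hB : ClosedUnder T SB) :
    ClosedUnder T
      {p : (W × W) × Act × ℝ |
        ∃ a b α x y, (a, α, x) ∈ SA ∧ (b, α, y) ∈ SB ∧
          p = ((a, b), α, min x y)} := by
  rintro _ α β z _ hz ⟨a, b, _, x, y, hx, hy, h⟩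
  obtain ⟨rfl, rfl, rfl⟩ := by simpa only [Prod.mk.injEq] using h
  exact ⟨a, b, α, z * x, z * y, hA a α _ z x hz hx, hB b α _ z y hz hy,
    by rw [mul_min_of_nonneg x y (hT _ _ _ hz)]⟩
end
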